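/- If (Φ, E₊, E₋) is a generalized almost contact structure on W = V × V*, then Φ∘Φ∘Φ = −Φ, the vectors E₊ and E₋ are linearly independent, and the kernel of Φ equals the linear span of E₊ and E₋. -/

import Mathlib

open Module

noncomputable section

/-- The generalized tangent space `W = V × V*`. -/
abbrev GT (V : Type*) [AddCommGroup V] [Module ℝ V] := V × (V →ₗ[ℝ] ℝ)

/-- The canonical symmetric pairing `⟨(X,α),(Y,β)⟩ = (β X + α Y)/2` on `W = V × V*`. -/
def gpair {V : Type*} [AddCommGroup V] [Module ℝ V] (u v : GT V) : ℝ :=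
  (v.2 u.1 + u.2 v.1) / 2

theorem gpair_comm {V : Type*} [AddCommGroup V] [Module ℝ V] (u v : GT V) :
    gpair u v = gpair v u := by
  simp only [gpair]
  ring

theorem gpair_add_right {V : Type*} [AddCommGroup V] [Module ℝ V] (u v w : GT V) :
    gpair u (v + w) = gpair u v + gpair u w := by
  simp only [gpair, Prod.fst_add, Prod.snd_add, LinearMap.add_apply, map_add]
  ring

theorem gpair_smul_right {V : Type*} [AddCommGroup V] [Module ℝ V] (c : ℝ) (u v : GT V) :
    gpair u (c • v) = c * gpair u v := by
  simp only [gpair, Prod.smul_fst, Prod.smul_snd, LinearMap.smul_apply, map_smul, smul_eq_mul]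
  ring

theorem gpair_zero_right {V : Type*} [AddCommGroup V] [Module ℝ V] (u : GT V) :
    gpair u 0 = 0 := by
  simp [gpair]

/-- The distinguished null vectors of a generalized almost contact structure lie in the kernel. -/
theorem map_null_vector_eq_zero {V : Type*} [AddCommGroup V] [Module ℝ V]
    (Φ : GT V →ₗ[ℝ] GT V) (E F : GT V)
    (hskew : ∀ u v : GT V, gpair (Φ u) v = - gpair u (Φ v))
    (hsq : ∀ w : GT V, Φ (Φ w) = -w + (2 * gpair F w) • E + (2 * gpair E w) • F)
    (hE : gpair E E = 0) (hEF : 2 * gpair E F = 1) : Φ E = 0 := by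
  have hΦΦ : Φ (Φ E) = 0 := by
    rw [hsq, gpair_comm F E, hEF, hE]
    simp
  have horth : gpair E (Φ E) = 0 := by
    have h := hskew E E
    rw [gpair_comm] at h
    linarith
  have hΦE : Φ E = (2 * gpair F (Φ E)) • E := by
    have h := hsq (Φ E)
    rw [hΦΦ, map_zero, horth, mul_zero, zero_smul, add_zero] at h
    exact neg_add_eq_zero.mp h.symm
  have h0 : (2 * gpair F (Φ E)) • Φ E = 0 := by
    rw [← map_smul, ← hΦE, hΦΦ]
  rcases smul_eq_zero.mp h0 with h | h
  · rw [hΦE, h, zero_smul]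
  · exact h

/-- For a generalized almost contact structure `(Φ, E₊, E₋)` on `W = V × V*`,
`Φ∘Φ∘Φ = −Φ`, the vectors `E₊, E₋` are linearly independent, and `ker Φ = span {E₊, E₋}`. -/
theorem stmt1 {V : Type*} [AddCommGroup V] [Module ℝ V] [FiniteDimensional ℝ V]
    (Φ : GT V →ₗ[ℝ] GT V) (Ep Em : GT V)
    (hskew : ∀ u v : GT V, gpair (Φ u) v = - gpair u (Φ v))
    (hsq : ∀ w : GT V, Φ (Φ w) = -w + (2 * gpair Em w) • Ep + (2 * gpair Ep w) • Em)
    (hpp : gpair Ep Ep = 0) (hmm : gpair Em Em = 0)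
    (hpm : 2 * gpair Ep Em = 1) :
    (∀ w : GT V, Φ (Φ (Φ w)) = - Φ w) ∧
      LinearIndependent ℝ ![Ep, Em] ∧
      LinearMap.ker Φ = Submodule.span ℝ {Ep, Em} := by
  have hEp : Φ Ep = 0 := map_null_vector_eq_zero Φ Ep Em hskew hsq hpp hpm
  have hEm : Φ Em = 0 :=
    map_null_vector_eq_zero Φ Em Ep hskew (fun w => (hsq w).trans (add_right_comm _ _ _)) hmm
      (by rw [gpair_comm, hpm])
  refine ⟨fun w => ?_, ?_, ?_⟩
  · rw [hsq w]
    simp [hEp, hEm]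
  · rw [LinearIndependent.pair_iff]
    intro s t h
    have hs : gpair Em (s • Ep + t • Em) = 0 := by rw [h, gpair_zero_right]
    have ht : gpair Ep (s • Ep + t • Em) = 0 := by rw [h, gpair_zero_right]
    rw [gpair_add_right, gpair_smul_right, gpair_smul_right, hmm, gpair_comm Em Ep] at hs
    rw [gpair_add_right, gpair_smul_right, gpair_smul_right, hpp] at ht
    constructor
    · linear_combination 2 * hs - s * hpm
    · linear_combination 2 * ht - t * hpm
  · apply le_antisymm
    · intro w hw
      have h := hsq w
      rw [LinearMap.mem_ker.mp hw, map_zero, add_assoc] at h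
      rw [Submodule.mem_span_pair]
      exact ⟨_, _, (neg_add_eq_zero.mp h.symm).symm⟩
    · rw [Submodule.span_le]
      rintro w (rfl | rfl)
      · exact hEp
      · exact hEm
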